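/- For every τ ∈ ℕ₀ and every x ∈ 𝒳, the iterates of the dynamics satisfy the one-step bound F(x, Y_{τ+1}) − F(x, Y_τ) ≤ γ_τ ⟨X_τ − x, v(X_τ) − β_τ Aᵀ Λ_τ⟩ + γ_τ ⟨X_τ − x, ξ_{τ+1}⟩ + (γ_τ²/K)(C₁² β_τ² ‖Λ_τ‖₂² + 2 C₂² + 2 ‖ξ_{τ+1}‖_*²). -/

import Mathlib

open scoped Matrix
open Finset

/-- The standard inner product on the product space ∏ᵢ ℝ^{Dᵢ}. -/
def gInner {N : ℕ} {Dd : Fin N → ℕ} (x y : (i : Fin N) → Fin (Dd i) → ℝ) : ℝ :=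
  ∑ i, x i ⬝ᵥ y i

/-- The dual norm ‖y‖_* = sup{⟨y,x⟩ : ‖x‖ ≤ 1} of a norm `nrm` on ℝ^n. -/
noncomputable def dualN {n : ℕ} (nrm : (Fin n → ℝ) → ℝ) (y : Fin n → ℝ) : ℝ :=
  sSup {r : ℝ | ∃ x : Fin n → ℝ, nrm x ≤ 1 ∧ r = y ⬝ᵥ x}

/-- The dual norm ‖y‖_* = (Σᵢ ‖y⁽ⁱ⁾‖_{i,*}²)^{1/2} on the product space ∏ᵢ ℝ^{Dᵢ}. -/
noncomputable def gDualN {N : ℕ} {Dd : Fin N → ℕ} (nrm : ∀ i, (Fin (Dd i) → ℝ) → ℝ)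
    (y : (i : Fin N) → Fin (Dd i) → ℝ) : ℝ :=
  Real.sqrt (∑ i, dualN (nrm i) (y i) ^ 2)

/-- On a finite-dimensional real space, every linear functional is bounded with respect to every
norm, the norm being given as a bare function. -/
theorem LinearMap.exists_le_mul_of_isNorm {E : Type*} [AddCommGroup E] [Module ℝ E]
    [FiniteDimensional ℝ E] (nrm : E → ℝ) (h0 : ∀ x, nrm x = 0 ↔ x = 0)
    (hS : ∀ (c : ℝ) x, nrm (c • x) = |c| * nrm x)
    (hT : ∀ x y, nrm (x + y) ≤ nrm x + nrm y) (hnn : ∀ x, 0 ≤ nrm x) (f : E →ₗ[ℝ] ℝ) :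
    ∃ C, 0 ≤ C ∧ ∀ x, f x ≤ C * nrm x := by
  let : Norm E := ⟨nrm⟩
  have core : NormedSpace.Core ℝ E :=
    { norm_nonneg := hnn
      norm_smul := hS
      norm_triangle := hT
      norm_eq_zero_iff := h0 }
  let : NormedAddCommGroup E := NormedAddCommGroup.ofCore core
  let : NormedSpace ℝ E := NormedSpace.ofCore core
  exact ⟨‖LinearMap.toContinuousLinearMap f‖, norm_nonneg _, fun x =>
    (le_abs_self _).trans ((LinearMap.toContinuousLinearMap f).le_opNorm x)⟩

section DualNorm

variable {n : ℕ} {nrm : (Fin n → ℝ) → ℝ}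

theorem nonneg_of_isNorm (h0 : ∀ x, nrm x = 0 ↔ x = 0)
    (hS : ∀ (c : ℝ) x, nrm (c • x) = |c| * nrm x)
    (hT : ∀ x y, nrm (x + y) ≤ nrm x + nrm y) (x : Fin n → ℝ) : 0 ≤ nrm x := by
  have h1 := hT x ((-1 : ℝ) • x)
  have h2 : nrm (x + (-1 : ℝ) • x) = 0 := (h0 _).2 (by simp)
  rw [h2, hS] at h1
  norm_num at h1
  linarith

theorem bddAbove_dualN (h0 : ∀ x, nrm x = 0 ↔ x = 0)
    (hS : ∀ (c : ℝ) x, nrm (c • x) = |c| * nrm x)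
    (hT : ∀ x y, nrm (x + y) ≤ nrm x + nrm y) (y : Fin n → ℝ) :
    BddAbove {r : ℝ | ∃ x : Fin n → ℝ, nrm x ≤ 1 ∧ r = y ⬝ᵥ x} := by
  obtain ⟨C, hC, h⟩ := LinearMap.exists_le_mul_of_isNorm nrm h0 hS hT
    (nonneg_of_isNorm h0 hS hT) (dotProductBilin ℝ ℝ y)
  refine ⟨C, ?_⟩
  rintro r ⟨x, hx, rfl⟩
  exact (h x).trans (mul_le_of_le_one_right hC hx)

theorem dotProduct_le_dualN_mul (h0 : ∀ x, nrm x = 0 ↔ x = 0)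
    (hS : ∀ (c : ℝ) x, nrm (c • x) = |c| * nrm x)
    (hT : ∀ x y, nrm (x + y) ≤ nrm x + nrm y) (y x : Fin n → ℝ) :
    y ⬝ᵥ x ≤ dualN nrm y * nrm x := by
  by_cases hx : x = 0
  · rw [hx, (h0 0).2 rfl]; simp
  have hpos : 0 < nrm x :=
    lt_of_le_of_ne (nonneg_of_isNorm h0 hS hT x) (fun h => hx ((h0 x).1 h.symm))
  have h := le_csSup (bddAbove_dualN h0 hS hT y)
    ⟨(nrm x)⁻¹ • x, by rw [hS, abs_of_pos (inv_pos.2 hpos), inv_mul_cancel₀ hpos.ne'], rfl⟩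
  rw [dotProduct_smul, smul_eq_mul, inv_mul_le_iff₀ hpos, mul_comm] at h
  exact h

theorem neg_dotProduct_le_dualN_mul (h0 : ∀ x, nrm x = 0 ↔ x = 0)
    (hS : ∀ (c : ℝ) x, nrm (c • x) = |c| * nrm x)
    (hT : ∀ x y, nrm (x + y) ≤ nrm x + nrm y) (y x : Fin n → ℝ) :
    -(y ⬝ᵥ x) ≤ dualN nrm y * nrm x := by
  have h := dotProduct_le_dualN_mul h0 hS hT y ((-1 : ℝ) • x)
  rw [hS] at h
  simpa using h

/-- Quadratic growth away from the maximizer of a linear functional minus a strongly convex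
function. -/
theorem add_sq_le_of_isMaxOn {S : Set (Fin n → ℝ)} (hS : Convex ℝ S) {k : ℝ} (hk : 0 ≤ k)
    {ψ : (Fin n → ℝ) → ℝ}
    (hψ : ∀ x ∈ S, ∀ y ∈ S, ∀ t ∈ Set.Icc (0 : ℝ) 1,
      ψ (t • x + (1 - t) • y) ≤ t * ψ x + (1 - t) * ψ y - k / 2 * t * (1 - t) * nrm (x - y) ^ 2)
    {y z p : Fin n → ℝ} (hz : z ∈ S) (hmax : IsMaxOn (fun x => y ⬝ᵥ x - ψ x) S z) (hp : p ∈ S) :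
    y ⬝ᵥ p - ψ p + k / 2 * nrm (p - z) ^ 2 ≤ y ⬝ᵥ z - ψ z := by
  set c := k / 2 * nrm (p - z) ^ 2 with hc
  have hc0 : 0 ≤ c := by positivity
  have key : ∀ t : ℝ, 0 < t → t ≤ 1 → c * (1 - t) ≤ (y ⬝ᵥ z - ψ z) - (y ⬝ᵥ p - ψ p) := by
    intro t ht ht1
    have h1 := hψ p hp z hz t ⟨ht.le, ht1⟩
    have h2 : y ⬝ᵥ (t • p + (1 - t) • z) - ψ (t • p + (1 - t) • z) ≤ y ⬝ᵥ z - ψ z :=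
      hmax (hS hp hz ht.le (sub_nonneg.2 ht1) (by ring))
    rw [dotProduct_add, dotProduct_smul, dotProduct_smul, smul_eq_mul, smul_eq_mul] at h2
    refine le_of_mul_le_mul_left ?_ ht
    rw [hc]
    linarith
  by_contra! hlt
  have hD := key 1 one_pos le_rfl
  have hcpos : 0 < c := by linarith
  have h := key ((c - ((y ⬝ᵥ z - ψ z) - (y ⬝ᵥ p - ψ p))) / (2 * c))
    (div_pos (by linarith) (by linarith)) ((div_le_one (by linarith)).2 (by linarith))
  have e : c * (1 - (c - ((y ⬝ᵥ z - ψ z) - (y ⬝ᵥ p - ψ p))) / (2 * c)) =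
      c - (c - ((y ⬝ᵥ z - ψ z) - (y ⬝ᵥ p - ψ p))) / 2 := by
    field_simp
  rw [e] at h
  linarith

end DualNorm

theorem mul_sub_sq_le_of_three_terms {K k g a b c d : ℝ} (hK : 0 < K) (hk : K ≤ k) :
    g * (a + b + c) * d - k / 2 * d ^ 2 ≤ g ^ 2 / K * (a ^ 2 + 2 * b ^ 2 + 2 * c ^ 2) := by
  have h1 : g * (a + b + c) * d - K / 2 * d ^ 2 ≤ (g * (a + b + c)) ^ 2 / (2 * K) := by
    rw [le_div_iff₀ (by linarith)]
    nlinarith [sq_nonneg (g * (a + b + c) - K * d)]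
  have h2 : (g * (a + b + c)) ^ 2 / (2 * K) ≤ g ^ 2 / K * (a ^ 2 + 2 * b ^ 2 + 2 * c ^ 2) := by
    have e : (g * (a + b + c)) ^ 2 / (2 * K) = g ^ 2 / K * ((a + b + c) ^ 2 / 2) := by
      field_simp
    rw [e]
    gcongr
    nlinarith [sq_nonneg (a - (b + c)), sq_nonneg (b - c)]
  nlinarith [mul_le_mul_of_nonneg_right hk (sq_nonneg d)]

theorem sum_dualN_sq {N : ℕ} {Dd : Fin N → ℕ} (nrm : ∀ i, (Fin (Dd i) → ℝ) → ℝ)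
    (y : (i : Fin N) → Fin (Dd i) → ℝ) : ∑ i, dualN (nrm i) (y i) ^ 2 = gDualN nrm y ^ 2 :=
  (Real.sq_sqrt (sum_nonneg fun _ _ => sq_nonneg _)).symm

/-- **One-step Fenchel-coupling bound along the controlled OMD dynamics (Lemma 1, one step).**
For every τ ∈ ℕ₀ and every x ∈ 𝒳 = ∏ᵢ𝒳ᵢ:
F(x,Y_{τ+1}) − F(x,Y_τ) ≤ γ_τ⟨X_τ − x, v(X_τ) − β_τAᵀΛ_τ⟩ + γ_τ⟨X_τ − x, ξ_{τ+1}⟩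
 + (γ_τ²/K)(C₁²β_τ²‖Λ_τ‖₂² + 2C₂² + 2‖ξ_{τ+1}‖_*²).  (Here ‖·‖₂² = ⟨·,·⟩.) -/
theorem stmt4 {N R : ℕ} (Dd : Fin N → ℕ)
    -- the agents' action sets 𝒳ᵢ: nonempty, compact, convex
    (Xset : ∀ i, Set (Fin (Dd i) → ℝ))
    (hXne : ∀ i, (Xset i).Nonempty) (hXcomp : ∀ i, IsCompact (Xset i))
    (hXconv : ∀ i, Convex ℝ (Xset i))
    -- the agents' norms ‖·‖ᵢ
    (nrm : ∀ i, (Fin (Dd i) → ℝ) → ℝ)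
    (hnrm0 : ∀ i x, nrm i x = 0 ↔ x = 0)
    (hnrmS : ∀ i (c : ℝ) x, nrm i (c • x) = |c| * nrm i x)
    (hnrmT : ∀ i x y, nrm i (x + y) ≤ nrm i x + nrm i y)
    -- the regularizers ψᵢ: continuous and Kᵢ-strongly convex; K = minᵢ Kᵢ
    (Ks : Fin N → ℝ) (hKs : ∀ i, 0 < Ks i) (K : ℝ) (hK : IsLeast (Set.range Ks) K)
    (ψ : ∀ i, (Fin (Dd i) → ℝ) → ℝ) (hψcont : ∀ i, ContinuousOn (ψ i) (Xset i))
    (hψsc : ∀ i, ∀ x ∈ Xset i, ∀ y ∈ Xset i, ∀ t ∈ Set.Icc (0 : ℝ) 1,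
      ψ i (t • x + (1 - t) • y) ≤ t * ψ i x + (1 - t) * ψ i y
        - Ks i / 2 * t * (1 - t) * nrm i (x - y) ^ 2)
    -- the mirror maps Φᵢ and the total Fenchel coupling F
    (Φ : ∀ i, (Fin (Dd i) → ℝ) → (Fin (Dd i) → ℝ))
    (hΦmem : ∀ i y, Φ i y ∈ Xset i)
    (hΦmax : ∀ i y, IsMaxOn (fun x => y ⬝ᵥ x - ψ i x) (Xset i) (Φ i y))
    (F : ((i : Fin N) → Fin (Dd i) → ℝ) → ((i : Fin N) → Fin (Dd i) → ℝ) → ℝ)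
    (hF : ∀ x y, F x y = ∑ i,
      (ψ i (x i) + (y i ⬝ᵥ Φ i (y i) - ψ i (Φ i (y i))) - y i ⬝ᵥ x i))
    -- the gradient map v, the resource matrix A (as a linear map), its transpose At, capacity b
    (v : ((i : Fin N) → Fin (Dd i) → ℝ) → ((i : Fin N) → Fin (Dd i) → ℝ))
    (A : ((i : Fin N) → Fin (Dd i) → ℝ) →ₗ[ℝ] (Fin R → ℝ))
    (At : (Fin R → ℝ) →ₗ[ℝ] ((i : Fin N) → Fin (Dd i) → ℝ))
    (hadj : ∀ x lam, A x ⬝ᵥ lam = gInner x (At lam))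
    (b : Fin R → ℝ)
    -- the constants C₁, C₂, C₃
    (C₁ C₂ C₃ : ℝ) (hC₁0 : 0 ≤ C₁) (hC₂0 : 0 ≤ C₂) (hC₃0 : 0 ≤ C₃)
    (hC₁ : ∀ lam : Fin R → ℝ, (∀ r, 0 ≤ lam r) →
      gDualN nrm (At lam) ≤ C₁ * Real.sqrt (lam ⬝ᵥ lam))
    (hC₂ : ∀ x, (∀ i, x i ∈ Xset i) → gDualN nrm (v x) ≤ C₂)
    (hC₃ : ∀ x, (∀ i, x i ∈ Xset i) →
      Real.sqrt ((A x - b) ⬝ᵥ (A x - b)) ≤ C₃)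
    -- the step sizes, price progressivity and price sensitivity
    (γ ζ η β : ℕ → ℝ)
    (hγ : ∀ τ, 0 < γ τ) (hζ : ∀ τ, ζ τ ∈ Set.Ioo (0 : ℝ) 1)
    (hη : ∀ τ, 0 ≤ η τ) (hβ : ∀ τ, 0 ≤ β τ)
    -- the dynamics
    (ξ : ℕ → (i : Fin N) → Fin (Dd i) → ℝ)
    (Y : ℕ → (i : Fin N) → Fin (Dd i) → ℝ)
    (Λ : ℕ → Fin R → ℝ) (hΛ0 : ∀ r, 0 ≤ Λ 0 r)
    (X : ℕ → (i : Fin N) → Fin (Dd i) → ℝ)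
    (hX : ∀ τ i, X τ i = Φ i (Y τ i))
    (hY : ∀ τ, Y (τ + 1) = Y τ + γ τ • (v (X τ) + ξ (τ + 1) - β τ • At (Λ τ)))
    (hΛ : ∀ τ r, Λ (τ + 1) r = max ((1 - η τ) * Λ τ r + ζ τ * (A (X τ) - b) r) 0) :
    ∀ (τ : ℕ) (x : (i : Fin N) → Fin (Dd i) → ℝ), (∀ i, x i ∈ Xset i) →
      F x (Y (τ + 1)) - F x (Y τ) ≤
        γ τ * gInner (X τ - x) (v (X τ) - β τ • At (Λ τ))
        + γ τ * gInner (X τ - x) (ξ (τ + 1))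
        + γ τ ^ 2 / K * (C₁ ^ 2 * β τ ^ 2 * (Λ τ ⬝ᵥ Λ τ)
          + 2 * C₂ ^ 2 + 2 * gDualN nrm (ξ (τ + 1)) ^ 2) := by
  intro τ x hx
  obtain ⟨⟨i₀, hi₀⟩, hKle⟩ := hK
  have hKpos : 0 < K := hi₀ ▸ hKs i₀
  have hΛnn : ∀ r, 0 ≤ Λ τ r := by
    cases τ with
    | zero => exact hΛ0
    | succ k => exact fun r => by rw [hΛ]; exact le_max_right _ _
  have hA : gDualN nrm (At (Λ τ)) ^ 2 ≤ C₁ ^ 2 * (Λ τ ⬝ᵥ Λ τ) := by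
    have h := pow_le_pow_left₀ (Real.sqrt_nonneg _) (hC₁ _ hΛnn) 2
    have hnn : 0 ≤ Λ τ ⬝ᵥ Λ τ := sum_nonneg fun r _ => mul_self_nonneg _
    rwa [mul_pow, Real.sq_sqrt hnn] at h
  have hV : gDualN nrm (v (X τ)) ^ 2 ≤ C₂ ^ 2 :=
    pow_le_pow_left₀ (Real.sqrt_nonneg _)
      (hC₂ _ fun i => by rw [hX]; exact hΦmem i _) 2
  have agent : ∀ i,
      (ψ i (x i) + (Y (τ + 1) i ⬝ᵥ Φ i (Y (τ + 1) i) - ψ i (Φ i (Y (τ + 1) i)))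
          - Y (τ + 1) i ⬝ᵥ x i)
        - (ψ i (x i) + (Y τ i ⬝ᵥ Φ i (Y τ i) - ψ i (Φ i (Y τ i))) - Y τ i ⬝ᵥ x i) ≤
      γ τ * ((X τ - x) i ⬝ᵥ (v (X τ) - β τ • At (Λ τ)) i)
        + γ τ * ((X τ - x) i ⬝ᵥ ξ (τ + 1) i)
        + γ τ ^ 2 / K * (β τ ^ 2 * dualN (nrm i) (At (Λ τ) i) ^ 2
          + 2 * dualN (nrm i) (v (X τ) i) ^ 2 + 2 * dualN (nrm i) (ξ (τ + 1) i) ^ 2) := by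
    intro i
    have hgrow := add_sq_le_of_isMaxOn (nrm := nrm i) (hXconv i) (hKs i).le (hψsc i) (hΦmem i _)
      (hΦmax i (Y τ i)) (hΦmem i (Y (τ + 1) i))
    have hstep : ∀ u, Y (τ + 1) i ⬝ᵥ u = Y τ i ⬝ᵥ u
        + γ τ * (v (X τ) i ⬝ᵥ u + ξ (τ + 1) i ⬝ᵥ u - β τ * (At (Λ τ) i ⬝ᵥ u)) := by
      intro u
      rw [hY]
      simp [add_dotProduct, sub_dotProduct, smul_dotProduct]
    rw [← hX τ i] at hgrow ⊢
    rw [hstep, hstep]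
    generalize hp : Φ i (Y (τ + 1) i) = p at *
    set d := nrm i (p - X τ i)
    have h1 := dotProduct_le_dualN_mul (hnrm0 i) (hnrmS i) (hnrmT i) (v (X τ) i) (p - X τ i)
    have h2 := dotProduct_le_dualN_mul (hnrm0 i) (hnrmS i) (hnrmT i) (ξ (τ + 1) i) (p - X τ i)
    have h3 := mul_le_mul_of_nonneg_left
      (neg_dotProduct_le_dualN_mul (hnrm0 i) (hnrmS i) (hnrmT i) (At (Λ τ) i) (p - X τ i)) (hβ τ)
    have hquad := mul_sub_sq_le_of_three_terms (g := γ τ)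
      (a := β τ * dualN (nrm i) (At (Λ τ) i)) (b := dualN (nrm i) (v (X τ) i))
      (c := dualN (nrm i) (ξ (τ + 1) i)) (d := d) hKpos (hKle ⟨i, rfl⟩)
    have hlin := mul_le_mul_of_nonneg_left (add_le_add (add_le_add h1 h2) h3) (hγ τ).le
    simp only [dotProduct_sub] at hlin
    have e1 : (X τ - x) i ⬝ᵥ (v (X τ) - β τ • At (Λ τ)) i =
        v (X τ) i ⬝ᵥ X τ i - v (X τ) i ⬝ᵥ x i
          - β τ * (At (Λ τ) i ⬝ᵥ X τ i - At (Λ τ) i ⬝ᵥ x i) := by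
      rw [dotProduct_comm]
      simp [dotProduct_sub, sub_dotProduct, smul_dotProduct]
      ring
    have e2 : (X τ - x) i ⬝ᵥ ξ (τ + 1) i = ξ (τ + 1) i ⬝ᵥ X τ i - ξ (τ + 1) i ⬝ᵥ x i := by
      rw [dotProduct_comm]
      simp [dotProduct_sub]
    rw [mul_pow] at hquad
    rw [e1, e2]
    linarith
  rw [hF, hF, ← sum_sub_distrib]
  refine (sum_le_sum fun i _ => agent i).trans ?_
  simp only [sum_add_distrib, ← mul_sum, sum_dualN_sq]
  unfold gInner
  have hγK : 0 ≤ γ τ ^ 2 / K := by positivity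
  refine add_le_add le_rfl (mul_le_mul_of_nonneg_left ?_ hγK)
  linarith [mul_le_mul_of_nonneg_left hA (sq_nonneg (β τ))]
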